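/- Let R be a commutative ring, M a finitely presented R-module, and n a natural number. Then the set {p ∈ Spec R | dim_{κ(p)}(M ⊗_R κ(p)) ≤ n} is open in the Zariski topology on Spec R; that is, the fiber dimension of a finitely presented module is an upper semicontinuous function on the prime spectrum. -/

import Mathlib

open TensorProduct

/-- The residue field `κ(p)` of a prime ideal `p` of a commutative ring `R`. -/
noncomputable def residueFieldAt {R : Type*} [CommRing R] (p : PrimeSpectrum R) :
    Type _ :=
  IsLocalRing.ResidueField (Localization.AtPrime p.asIdeal)

noncomputable instance {R : Type*} [CommRing R] (p : PrimeSpectrum R) :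
    Field (residueFieldAt p) :=
  inferInstanceAs (Field (IsLocalRing.ResidueField (Localization.AtPrime p.asIdeal)))

noncomputable instance {R : Type*} [CommRing R] (p : PrimeSpectrum R) :
    Algebra R (residueFieldAt p) :=
  inferInstanceAs (Algebra R (IsLocalRing.ResidueField (Localization.AtPrime p.asIdeal)))

/-- The base change of a quotient `M ⧸ N` vanishes iff `N` generates the base change of `M`. -/
theorem Submodule.subsingleton_tensorProduct_quotient_iff_baseChange_eq_top
    {R A M : Type*} [CommRing R] [CommRing A] [Algebra R A] [AddCommGroup M] [Module R M]
    (N : Submodule R M) :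
    Subsingleton (A ⊗[R] (M ⧸ N)) ↔ N.baseChange A = ⊤ := by
  have hsurj : Function.Surjective (N.mkQ.lTensor A) :=
    LinearMap.lTensor_surjective A N.mkQ_surjective
  have hker : (N.baseChange A).restrictScalars R = LinearMap.ker (N.mkQ.lTensor A) := by
    rw [lTensor_mkQ]
    rfl
  rw [← Submodule.restrictScalars_eq_top_iff R A, hker, LinearMap.ker_eq_top]
  constructor
  · intro h
    exact LinearMap.ext fun _ => Subsingleton.elim _ _
  · intro h
    refine subsingleton_of_forall_eq 0 fun x => ?_
    obtain ⟨y, rfl⟩ := hsurj x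
    rw [h, LinearMap.zero_apply]

/-- The base change of a finite module to a field `K` has dimension at most `n` iff it is generated
by the images of at most `n` elements of the module. -/
theorem Module.finrank_tensorProduct_le_iff_exists_finset
    {R K M : Type*} [CommRing R] [Field K] [Algebra R K] [AddCommGroup M] [Module R M]
    [Module.Finite R M] (n : ℕ) :
    Module.finrank K (K ⊗[R] M) ≤ n ↔
      ∃ s : Finset M, s.card ≤ n ∧
        Subsingleton (K ⊗[R] (M ⧸ Submodule.span R (s : Set M))) := by
  classical
  simp_rw [Submodule.subsingleton_tensorProduct_quotient_iff_baseChange_eq_top,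
    Submodule.baseChange_span]
  constructor
  · intro h
    have htop : Submodule.span K (Set.range (TensorProduct.mk R K M 1)) = ⊤ := by
      rw [← Set.image_univ, ← Submodule.baseChange_span, Submodule.span_univ,
        Submodule.baseChange_top]
    obtain ⟨f, hf, hspan, -⟩ :=
      Submodule.exists_fun_fin_finrank_span_eq K (Set.range (TensorProduct.mk R K M 1))
    choose v hv using hf
    refine ⟨Finset.univ.image v, Finset.card_image_le.trans ?_, ?_⟩
    · rwa [Finset.card_univ, Fintype.card_fin, htop, finrank_top]
    · rw [Finset.coe_image, Finset.coe_univ, Set.image_univ, ← Set.range_comp, ← htop]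
      rwa [← funext hv] at hspan
  · rintro ⟨s, hs, hspan⟩
    rw [← Finset.coe_image] at hspan
    rw [← finrank_top K (K ⊗[R] M), ← hspan]
    exact (finrank_span_finset_le_card _).trans (Finset.card_image_le.trans hs)

/-- The fiber dimension of a finite module is upper semicontinuous. -/
theorem Module.isOpen_setOf_finrank_residueField_tensorProduct_le
    (R M : Type*) [CommRing R] [AddCommGroup M] [Module R M] [Module.Finite R M] (n : ℕ) :
    IsOpen {p : PrimeSpectrum R |
      Module.finrank p.asIdeal.ResidueField (p.asIdeal.ResidueField ⊗[R] M) ≤ n} := by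
  simp_rw [Module.finrank_tensorProduct_le_iff_exists_finset, ← not_nontrivial_iff_subsingleton,
    ← Module.mem_support_iff_nontrivial_residueField_tensorProduct, Set.ofPred_exists]
  refine isOpen_iUnion fun s => ?_
  rw [Set.ofPred_and]
  exact isOpen_const.inter (Module.isClosed_support (R := R)).isOpen_compl

/-- The fiber dimension of a finitely presented module is upper semicontinuous:
`{p ∈ Spec R | dim_{κ(p)} (M ⊗_R κ(p)) ≤ n}` is Zariski-open. -/
theorem isOpen_fiber_dim_le_of_finitePresentation
    (R : Type*) [CommRing R] (M : Type*) [AddCommGroup M] [Module R M]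
    [Module.FinitePresentation R M] (n : ℕ) :
    IsOpen {p : PrimeSpectrum R |
      Module.finrank (residueFieldAt p) (residueFieldAt p ⊗[R] M) ≤ n} := by
  exact Module.isOpen_setOf_finrank_residueField_tensorProduct_le R M n
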